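/- Let b_n be the coefficient of q^n in ∏_{m=1}^∞ (1 - q^m)^2 (1 - q^{2m})^2. Let g : ℕ → ℤ be the multiplicative arithmetic function determined on prime powers p^r (r ≥ 1) by: g(p^r) = (-1)^{r/2} p^{r/2} if p ≡ 3 (mod 4) and r is even; if p ≡ 1 (mod 4), then, writing (u, v) for the unique pair of positive integers with p = u^2 + v^2, u odd and v even, g(p^r) is the integer whose image in ℂ equals ε·[(u + i·v)^{r+1} − (u − i·v)^{r+1}]/(2i·v), where ε = (−1)^{(u+v−1)/2} if r is odd and ε = 1 if r is even; and g(p^r) = 0 in all remaining cases. Then b_n = g(4n + 1) for all n ≥ 0. -/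

import Mathlib

open Finset Polynomial

/-- The finite product `(1 - q)(1 - q ^ 2) ⋯ (1 - q ^ n)`. -/
def qPochhammer {R : Type*} [CommRing R] (q : R) (n : ℕ) : R :=
  ∏ i ∈ range n, (1 - q ^ (i + 1))

/-- The Gaussian binomial coefficient, evaluated at `q`. -/
def qBinom {R : Type*} [CommRing R] (q : R) : ℕ → ℕ → R
  | _, 0 => 1
  | 0, _ + 1 => 0
  | n + 1, k + 1 => qBinom q n k + q ^ (k + 1) * qBinom q n (k + 1)

section QSeries

variable {R : Type*} [CommRing R] (q : R)

lemma qPochhammer_succ (n : ℕ) :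
    qPochhammer q (n + 1) = qPochhammer q n * (1 - q ^ (n + 1)) :=
  prod_range_succ _ _

lemma qBinom_zero_right (n : ℕ) : qBinom q n 0 = 1 := by cases n <;> rfl

lemma qBinom_succ_succ (n k : ℕ) :
    qBinom q (n + 1) (k + 1) = qBinom q n k + q ^ (k + 1) * qBinom q n (k + 1) := rfl

lemma qBinom_eq_zero_of_lt {n k : ℕ} (h : n < k) : qBinom q n k = 0 := by
  induction n generalizing k with
  | zero => cases k with
    | zero => omega
    | succ k => rfl
  | succ n ih => cases k with
    | zero => omega
    | succ k => rw [qBinom_succ_succ, ih (by omega), ih (by omega)]; simp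

lemma qBinom_self (n : ℕ) : qBinom q n n = 1 := by
  induction n with
  | zero => rfl
  | succ n ih => rw [qBinom_succ_succ, ih, qBinom_eq_zero_of_lt q (by omega)]; simp

lemma qBinom_add_mul (k l : ℕ) :
    qBinom q (k + l) k * (qPochhammer q k * qPochhammer q l) = qPochhammer q (k + l) := by
  induction k generalizing l with
  | zero => simp [qBinom_zero_right, qPochhammer]
  | succ k ihk => induction l with
    | zero => simp [qBinom_self, qPochhammer]
    | succ l ihl =>
      have h1 := ihk (l + 1)
      have h2 := ihl
      rw [show k + 1 + l = k + (l + 1) by ring] at h2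
      rw [show k + 1 + (l + 1) = k + (l + 1) + 1 by ring, qBinom_succ_succ,
        qPochhammer_succ q (k + (l + 1)), qPochhammer_succ q l, qPochhammer_succ q k]
      rw [qPochhammer_succ q l] at h1
      rw [qPochhammer_succ q k] at h2
      linear_combination (1 - q ^ (k + 1)) * h1 + q ^ (k + 1) * (1 - q ^ (l + 1)) * h2

/-- The finite `q`-binomial theorem. -/
lemma prod_add_mul_pow_eq_sum_qBinom (a b : R) (n : ℕ) :
    ∏ j ∈ range n, (a + b * q ^ j) =
      ∑ k ∈ range (n + 1), qBinom q n k * q ^ k.choose 2 * b ^ k * a ^ (n - k) := by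
  induction n generalizing b with
  | zero => simp [qBinom_zero_right]
  | succ n ih =>
    rw [prod_range_succ']
    have h : ∏ j ∈ range n, (a + b * q ^ (j + 1)) = ∏ j ∈ range n, (a + (b * q) * q ^ j) :=
      prod_congr rfl fun j _ => by ring
    rw [h, ih, pow_zero, mul_one, mul_add, sum_range_succ' _ (n + 1)]
    simp only [qBinom_succ_succ, add_mul, sum_add_distrib]
    rw [sum_range_succ (fun k => q ^ (k + 1) * qBinom q n (k + 1) * q ^ (k + 1).choose 2 *
      b ^ (k + 1) * a ^ (n + 1 - (k + 1))), qBinom_eq_zero_of_lt q (Nat.lt_succ_self n)]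
    have h1 : (∑ k ∈ range (n + 1), qBinom q n k * q ^ k.choose 2 * (b * q) ^ k * a ^ (n - k)) * b
        = ∑ k ∈ range (n + 1), qBinom q n k * q ^ (k + 1).choose 2 * b ^ (k + 1) *
          a ^ (n + 1 - (k + 1)) := by
      rw [sum_mul]
      refine sum_congr rfl fun k _ => ?_
      rw [Nat.choose_succ_succ' k 1, Nat.choose_one_right, Nat.add_sub_add_right]
      ring
    have h2 : (∑ k ∈ range (n + 1), qBinom q n k * q ^ k.choose 2 * (b * q) ^ k * a ^ (n - k)) * a
        = (∑ k ∈ range n, q ^ (k + 1) * qBinom q n (k + 1) * q ^ (k + 1).choose 2 *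
          b ^ (k + 1) * a ^ (n + 1 - (k + 1))) + a ^ (n + 1) := by
      rw [sum_range_succ', add_mul, sum_mul]
      congr 1
      · refine sum_congr rfl fun k hk => ?_
        rw [Nat.add_sub_add_right, show n - k = n - (k + 1) + 1 by have := mem_range.1 hk; omega]
        ring
      · simp [qBinom_zero_right, pow_succ]
    rw [h1, h2]
    simp [qBinom_zero_right]
    ring

lemma dvd_qPochhammer_sub {d n : ℕ} (h : d ≤ n) :
    q ^ (d + 1) ∣ qPochhammer q n - qPochhammer q d := by
  induction n, h using Nat.le_induction with
  | base => simp
  | succ n h ih =>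
    rw [qPochhammer_succ, show qPochhammer q n * (1 - q ^ (n + 1)) - qPochhammer q d =
      qPochhammer q n - qPochhammer q d - q ^ (n + 1) * qPochhammer q n by ring]
    exact dvd_sub ih (Dvd.dvd.mul_right (pow_dvd_pow q (by omega)) _)

lemma isCoprime_pow_qPochhammer (m n : ℕ) : IsCoprime (q ^ m) (qPochhammer q n) := by
  refine IsCoprime.pow_left (IsCoprime.prod_right fun i _ => ?_)
  exact ⟨q ^ i, 1, by ring⟩

lemma dvd_qPochhammer_mul_qBinom_sub_one {n k l d : ℕ} (hk : d ≤ k) (hl : d ≤ l) (hn : d ≤ n) :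
    q ^ (d + 1) ∣ qPochhammer q n * qBinom q (k + l) k - 1 := by
  refine (isCoprime_pow_qPochhammer q (d + 1) d).dvd_of_dvd_mul_left ?_
  obtain ⟨x, hx⟩ := dvd_qPochhammer_sub q hk
  obtain ⟨y, hy⟩ := dvd_qPochhammer_sub q hl
  obtain ⟨z, hz⟩ := dvd_qPochhammer_sub q hn
  obtain ⟨w, hw⟩ := dvd_qPochhammer_sub q (show d ≤ k + l by omega)
  have h := qBinom_add_mul q k l
  rw [sub_eq_iff_eq_add'] at hx hy hz hw
  rw [hw, hx, hy] at h
  rw [hz]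
  refine ⟨qPochhammer q d * z * qBinom q (k + l) k + w - qBinom q (k + l) k *
    (qPochhammer q d * y + x * qPochhammer q d + q ^ (d + 1) * x * y), ?_⟩
  linear_combination h


lemma map_qBinom {S : Type*} [CommRing S] (f : R →+* S) (n k : ℕ) :
    f (qBinom q n k) = qBinom (f q) n k := by
  induction n generalizing k with
  | zero => cases k <;> simp [qBinom]
  | succ n ih => cases k <;> simp [qBinom, ih]

lemma prod_pow_sub_pow_of_lt (n : ℕ) :
    ∏ j ∈ range n, (q ^ n - q ^ j) = (-1) ^ n * q ^ n.choose 2 * qPochhammer q n := by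
  have h : ∀ j ∈ range n, q ^ n - q ^ j = -1 * q ^ j * (1 - q ^ (n - 1 - j + 1)) := fun j hj => by
    have := mem_range.1 hj
    rw [mul_sub, mul_assoc _ (q ^ j) (q ^ _), ← pow_add, show j + (n - 1 - j + 1) = n by omega]
    ring
  rw [prod_congr rfl h, prod_mul_distrib, prod_mul_distrib, prod_const, card_range,
    prod_pow_eq_pow_sum, sum_range_id, ← Nat.choose_two_right,
    prod_range_reflect (fun j => 1 - q ^ (j + 1)), qPochhammer]

lemma choose_two_mul_two_add (k : ℕ) : k.choose 2 * 2 + k = k * k := by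
  induction k with
  | zero => rfl
  | succ k ih =>
    rw [Nat.choose_succ_succ' k 1, Nat.choose_one_right]
    linarith

lemma sum_qBinom_eq_qPochhammer_sq [IsDomain R] (hq : q ≠ 0) (n : ℕ) :
    ∑ m ∈ range (n + 1), (-1) ^ m * q ^ (m + 1).choose 2 *
      ((n + 1 + m : ℕ) * qBinom q (2 * n + 1) (n + 1 + m)
        - (n - m : ℕ) * qBinom q (2 * n + 1) (n - m)) = qPochhammer q n ^ 2 := by
  have h := congrArg (fun f => (derivative f).eval 1)
    (prod_add_mul_pow_eq_sum_qBinom (C q) (C (q ^ n)) (-X) (2 * n + 1))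
  have hl : ∏ j ∈ range (2 * n + 1), (C (q ^ n) + -X * C q ^ j) =
      (∏ j ∈ range n, (C (q ^ n) + -X * C q ^ j)) *
        (∏ j ∈ range n, (C (q ^ n) + -X * C q ^ (n + 1 + j))) * C (q ^ n) * (1 - X) := by
    rw [show 2 * n + 1 = n + 1 + n by ring, prod_range_add, prod_range_succ, C_pow]
    ring
  have h1 : ∏ j ∈ range n, (q ^ n + -1 * q ^ j) =
      (-1) ^ n * q ^ n.choose 2 * qPochhammer q n := by
    rw [← prod_pow_sub_pow_of_lt]
    exact prod_congr rfl fun j _ => by ring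
  have h2 : ∏ j ∈ range n, (q ^ n + -1 * q ^ (n + 1 + j)) = q ^ (n * n) * qPochhammer q n := by
    have h' : ∀ j ∈ range n, q ^ n + -1 * q ^ (n + 1 + j) = q ^ n * (1 - q ^ (j + 1)) :=
      fun j _ => by ring
    rw [prod_congr rfl h', prod_mul_distrib, prod_const, card_range, ← pow_mul, qPochhammer]
  have hr : ∀ k, (derivative (qBinom (C q) (2 * n + 1) k * C q ^ k.choose 2 * (-X) ^ k *
      C (q ^ n) ^ (2 * n + 1 - k))).eval 1 =
      qBinom q (2 * n + 1) k * (-1) ^ k * k * q ^ (k.choose 2 + n * (2 * n + 1 - k)) := fun k => by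
    have hc : qBinom (C q) (2 * n + 1) k * C q ^ k.choose 2 * (-X) ^ k *
        C (q ^ n) ^ (2 * n + 1 - k) = C (qBinom q (2 * n + 1) k * q ^ k.choose 2 * (-1) ^ k *
          (q ^ n) ^ (2 * n + 1 - k)) * X ^ k := by
      simp only [← map_qBinom, C_mul, C_pow, C_neg, C_1]
      rw [neg_pow (X : R[X])]
      ring
    rw [hc, derivative_C_mul, derivative_X_pow, eval_mul, eval_C, eval_mul, eval_pow, eval_X,
      eval_C, one_pow, mul_one, ← pow_mul, pow_add]
    ring
  have hd : ∀ f : R[X], (derivative (f * (1 - X))).eval 1 = -f.eval 1 := fun f => by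
    simp [derivative_mul]
  simp only [hl, hd, derivative_sum, eval_finsetSum, hr, eval_add, eval_mul, eval_prod, eval_C,
    eval_pow, eval_neg, eval_X, h1, h2] at h
  rw [show 2 * n + 1 + 1 = (n + 1) + (n + 1) by ring, sum_range_add,
    ← sum_range_reflect _ (n + 1), ← sum_add_distrib] at h
  refine mul_left_cancel₀ (pow_ne_zero (n.choose 2 + n * n + n) hq)
    (mul_left_cancel₀ (pow_ne_zero (n + 1) (neg_ne_zero.2 (one_ne_zero (α := R)))) ?_)
  refine Eq.trans ?_ (h.symm.trans (by ring))
  rw [mul_sum, mul_sum]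
  refine sum_congr rfl fun m hm => ?_
  obtain ⟨t, rfl⟩ := Nat.exists_eq_add_of_le (Nat.lt_succ_iff.1 (mem_range.1 hm))
  have e1 : m + t + 1 - 1 - m = t := by omega
  have e2 : m + t - m = t := by omega
  have e3 : 2 * (m + t) + 1 - t = m + t + 1 + m := by omega
  have e4 : 2 * (m + t) + 1 - (m + t + 1 + m) = t := by omega
  have c1 := choose_two_mul_two_add (m + t)
  have c2 := choose_two_mul_two_add (m + 1)
  have c3 := choose_two_mul_two_add t
  have c4 := choose_two_mul_two_add (m + t + 1 + m)
  have e5 : t.choose 2 + (m + t) * (m + t + 1 + m) =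
      (m + t).choose 2 + (m + t) * (m + t) + (m + t) + (m + 1).choose 2 := by
    nlinarith
  have e6 : (m + t + 1 + m).choose 2 + (m + t) * t =
      (m + t).choose 2 + (m + t) * (m + t) + (m + t) + (m + 1).choose 2 := by
    nlinarith
  have s1 : (-1 : R) ^ t = (-1) ^ (m + t + 1) * (-1) ^ m * (-1) := by
    rw [show (-1 : R) ^ (m + t + 1) * (-1) ^ m * (-1) = (-1) ^ t * ((-1) ^ m * (-1) ^ m) by ring,
      ← mul_pow]
    simp
  rw [e1, e2, e3, e4, e5, e6, s1, pow_add (-1 : R) (m + t + 1) m, pow_add q _ ((m + 1).choose 2)]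
  ring

/-- A truncated form of Jacobi's identity for the cube of Euler's product. -/
lemma dvd_qPochhammer_cube_sub [IsDomain R] (hq : q ≠ 0) (n : ℕ) :
    q ^ (n + 1) ∣ qPochhammer q n ^ 3 -
      ∑ m ∈ range (n + 1), (-1) ^ m * (2 * m + 1) * q ^ (m + 1).choose 2 := by
  rw [pow_succ (qPochhammer q n) 2, ← sum_qBinom_eq_qPochhammer_sq q hq, sum_mul, ← sum_sub_distrib]
  refine dvd_sum fun m hm => ?_
  obtain ⟨t, rfl⟩ := Nat.exists_eq_add_of_le (Nat.lt_succ_iff.1 (mem_range.1 hm))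
  have h1 := dvd_qPochhammer_mul_qBinom_sub_one q (show t ≤ m + t + 1 + m by omega) le_rfl
    (show t ≤ m + t by omega)
  have h2 := dvd_qPochhammer_mul_qBinom_sub_one q le_rfl (show t ≤ m + t + 1 + m by omega)
    (show t ≤ m + t by omega)
  rw [show m + t + 1 + m + t = 2 * (m + t) + 1 by ring] at h1
  rw [show t + (m + t + 1 + m) = 2 * (m + t) + 1 by ring] at h2
  have h3 : q ^ (m + t + 1) ∣ q ^ (m + 1).choose 2 * q ^ (t + 1) := by
    rw [← pow_add, Nat.choose_succ_succ' m 1, Nat.choose_one_right]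
    exact pow_dvd_pow q (by omega)
  refine h3.trans ?_
  have h4 := mul_dvd_mul_left (q ^ (m + 1).choose 2)
    (((dvd_sub (h1.mul_left ((m + t + 1 + m : ℕ) : R)) (h2.mul_left (t : R)))).mul_left ((-1) ^ m))
  convert h4 using 1
  rw [show m + t - m = t by omega]
  push_cast
  ring

lemma sum_qBinom_eq_prod_odd_sq [IsDomain R] (hq : q ≠ 0) (n : ℕ) :
    ∑ k ∈ range (2 * n + 1), (-1) ^ (n + k) * qBinom (q ^ 2) (2 * n) k *
      q ^ ((k - n : ℤ).natAbs ^ 2) = (∏ j ∈ range n, (1 - q ^ (2 * j + 1))) ^ 2 := by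
  have h := prod_add_mul_pow_eq_sum_qBinom (q ^ 2) (q ^ (2 * n)) (-q) (2 * n)
  have h0 : ∑ j ∈ range n, (2 * j + 1) = n * n := by
    clear h
    induction n with
    | zero => rfl
    | succ n ih => rw [sum_range_succ, ih]; ring
  have h1 : ∏ j ∈ range n, (q ^ (2 * n) + -q * (q ^ 2) ^ j) =
      (-1) ^ n * q ^ (n * n) * ∏ j ∈ range n, (1 - q ^ (2 * j + 1)) := by
    have h' : ∀ j ∈ range n, q ^ (2 * n) + -q * (q ^ 2) ^ j =
        -1 * q ^ (2 * j + 1) * (1 - q ^ (2 * (n - 1 - j) + 1)) := fun j hj => by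
      have := mem_range.1 hj
      rw [mul_sub, mul_assoc _ (q ^ (2 * j + 1)) (q ^ _), ← pow_add,
        show 2 * j + 1 + (2 * (n - 1 - j) + 1) = 2 * n by omega]
      ring
    rw [prod_congr rfl h', prod_mul_distrib, prod_mul_distrib, prod_const, card_range,
      prod_pow_eq_pow_sum, h0, prod_range_reflect (fun j => 1 - q ^ (2 * j + 1))]
  have h2 : ∏ j ∈ range n, (q ^ (2 * n) + -q * (q ^ 2) ^ (n + j)) =
      q ^ (2 * n * n) * ∏ j ∈ range n, (1 - q ^ (2 * j + 1)) := by
    have h' : ∀ j ∈ range n, q ^ (2 * n) + -q * (q ^ 2) ^ (n + j) =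
        q ^ (2 * n) * (1 - q ^ (2 * j + 1)) := fun j _ => by ring
    rw [prod_congr rfl h', prod_mul_distrib, prod_const, card_range, ← pow_mul]
  rw [show range (2 * n) = range (n + n) by rw [two_mul], prod_range_add, h1, h2] at h
  refine mul_left_cancel₀ (pow_ne_zero (3 * n * n) hq)
    (mul_left_cancel₀ (pow_ne_zero n (neg_ne_zero.2 (one_ne_zero (α := R)))) ?_)
  refine Eq.trans ?_ (h.symm.trans (by ring))
  rw [mul_sum, mul_sum]
  refine sum_congr rfl fun k hk => ?_
  have e : 3 * n * n + (k - n : ℤ).natAbs ^ 2 = 2 * k.choose 2 + k + 2 * n * (2 * n - k) := by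
    have h1 := choose_two_mul_two_add k
    zify [show k ≤ 2 * n by have := mem_range.1 hk; omega] at h1 ⊢
    rw [sq_abs]
    linear_combination -h1
  have s : (-1 : R) ^ n * (-1) ^ n = 1 := by rw [← mul_pow]; simp
  rw [neg_pow q, ← pow_mul, ← pow_mul, pow_add (-1 : R)]
  calc _ = ((-1) ^ n * (-1) ^ n) * (-1) ^ k * qBinom (q ^ 2) (2 * n) k *
        q ^ (3 * n * n + (k - n : ℤ).natAbs ^ 2) := by ring
    _ = _ := by rw [s, e]; ring

/-- A truncated form of Gauss's product formula for `∑ (-1) ^ m * q ^ (m ^ 2)`. -/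
lemma dvd_qPochhammer_mul_prod_odd_sq_sub [IsDomain R] (hq : q ≠ 0) (n : ℕ) :
    q ^ (2 * n + 1) ∣ qPochhammer (q ^ 2) n * (∏ j ∈ range n, (1 - q ^ (2 * j + 1))) ^ 2 -
      ∑ k ∈ range (2 * n + 1), (-1) ^ (n + k) * q ^ ((k - n : ℤ).natAbs ^ 2) := by
  rw [← sum_qBinom_eq_prod_odd_sq q hq, mul_sum, ← sum_sub_distrib]
  refine dvd_sum fun k hk => ?_
  have hk' : k ≤ 2 * n := Nat.lt_succ_iff.1 (mem_range.1 hk)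
  set m := (k - n : ℤ).natAbs with hm
  have h := dvd_qPochhammer_mul_qBinom_sub_one (q ^ 2) (show n - m ≤ k by omega)
    (show n - m ≤ 2 * n - k by omega) (show n - m ≤ n by omega)
  rw [show k + (2 * n - k) = 2 * n by omega, ← pow_mul] at h
  have h3 : q ^ (2 * n + 1) ∣ q ^ (m ^ 2) * q ^ (2 * (n - m + 1)) := by
    rw [← pow_add]
    refine pow_dvd_pow q ?_
    have h4 : 2 * m ≤ m ^ 2 + 1 := by nlinarith [sq_nonneg ((m : ℤ) - 1)]
    omega
  refine h3.trans ((mul_dvd_mul_left _ (h.mul_left ((-1) ^ (n + k)))).trans (dvd_of_eq ?_))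
  ring

end QSeries

/-- A Gaussian integer is primary if its imaginary part is even and its real and imaginary parts
add up to `1` modulo `4`. Every Gaussian integer of odd norm has exactly one primary associate. -/
def GaussianInt.IsPrimary (α : GaussianInt) : Prop :=
  α.im % 2 = 0 ∧ (α.re + α.im) % 4 = 1

open Classical in
/-- The primary Gaussian integers of norm `N`. -/
noncomputable def primaryOfNorm (N : ℕ) : Finset GaussianInt :=
  ((Icc (-N : ℤ) N ×ˢ Icc (-N : ℤ) N).image fun x => (⟨x.1, x.2⟩ : GaussianInt)).filter
    fun α => α.norm = N ∧ α.IsPrimary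

lemma GaussianInt.norm_eq_sq_add_sq (α : GaussianInt) : α.norm = α.re ^ 2 + α.im ^ 2 := by
  rw [Zsqrtd.norm_def]
  ring

lemma mem_primaryOfNorm {N : ℕ} {α : GaussianInt} :
    α ∈ primaryOfNorm N ↔ α.norm = N ∧ α.IsPrimary := by
  simp only [primaryOfNorm, mem_filter, mem_image, mem_product, mem_Icc, and_iff_right_iff_imp]
  rintro ⟨h, -⟩
  rw [GaussianInt.norm_eq_sq_add_sq] at h
  refine ⟨(α.re, α.im), ⟨⟨?_, ?_⟩, ?_, ?_⟩, rfl⟩ <;> dsimp only <;>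
    nlinarith [sq_nonneg (α.re - 1), sq_nonneg (α.im - 1), sq_nonneg (α.re + 1),
      sq_nonneg (α.im + 1), sq_nonneg α.re, sq_nonneg α.im, h]

lemma qPochhammer_two_mul {R : Type*} [CommRing R] (q : R) (n : ℕ) :
    qPochhammer q (2 * n) = qPochhammer (q ^ 2) n * ∏ j ∈ range n, (1 - q ^ (2 * j + 1)) := by
  induction n with
  | zero => simp [qPochhammer]
  | succ n ih =>
    rw [show 2 * (n + 1) = 2 * n + 1 + 1 by ring, qPochhammer_succ, qPochhammer_succ, ih,
      qPochhammer_succ, prod_range_succ]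
    ring

lemma X_pow_dvd_prod_sub_mul (n : ℕ) :
    (X : ℤ[X]) ^ (2 * n + 1) ∣
      ∏ m ∈ Icc 1 (2 * n), ((1 - X ^ m) ^ 2 * (1 - X ^ (2 * m)) ^ 2) -
        (∑ k ∈ range (2 * n + 1), (-1) ^ (n + k) * X ^ ((k - n : ℤ).natAbs ^ 2)) *
          ∑ m ∈ range (n + 1), (-1) ^ m * (2 * m + 1) * (X ^ 2) ^ (m + 1).choose 2 := by
  have hX : (X : ℤ[X]) ≠ 0 := X_ne_zero
  have h0 : ∏ m ∈ Icc 1 (2 * n), (((1 : ℤ[X]) - X ^ m) ^ 2 * (1 - X ^ (2 * m)) ^ 2) =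
      (qPochhammer (X ^ 2) n * ∏ j ∈ range n, (1 - X ^ (2 * j + 1))) ^ 2 *
        qPochhammer (X ^ 2) (2 * n) ^ 2 := by
    rw [← qPochhammer_two_mul, prod_mul_distrib, prod_pow, prod_pow, qPochhammer, qPochhammer]
    simp_rw [← pow_mul]
    rw [range_eq_Ico, prod_Ico_add' (fun i => (1 : ℤ[X]) - X ^ i),
      prod_Ico_add' (fun i => (1 : ℤ[X]) - X ^ (2 * i))]
    rfl
  have h1 := dvd_qPochhammer_mul_prod_odd_sq_sub (X : ℤ[X]) hX n
  have hle : (X : ℤ[X]) ^ (2 * n + 1) ∣ (X ^ 2) ^ (n + 1) := by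
    rw [← pow_mul]
    exact pow_dvd_pow _ (by omega)
  have h2 := hle.trans (dvd_qPochhammer_cube_sub (X ^ 2 : ℤ[X]) (pow_ne_zero 2 hX) n)
  have h3 := hle.trans (dvd_qPochhammer_sub (X ^ 2 : ℤ[X]) (show n ≤ 2 * n by omega))
  rw [h0]
  obtain ⟨x, hx⟩ := h1
  obtain ⟨y, hy⟩ := h2
  obtain ⟨z, hz⟩ := h3
  generalize ∑ k ∈ range (2 * n + 1), (-1 : ℤ[X]) ^ (n + k) * X ^ ((k - n : ℤ).natAbs ^ 2) = A at *
  generalize ∑ m ∈ range (n + 1), (-1 : ℤ[X]) ^ m * (2 * m + 1) *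
    ((X : ℤ[X]) ^ 2) ^ (m + 1).choose 2 = B at *
  generalize ∏ j ∈ range n, ((1 : ℤ[X]) - X ^ (2 * j + 1)) = O at *
  generalize qPochhammer (X ^ 2 : ℤ[X]) (2 * n) = F at *
  generalize qPochhammer (X ^ 2 : ℤ[X]) n = E at *
  refine ⟨(E * O) ^ 2 * (F + E) * z + E ^ 3 * x + A * y, ?_⟩
  linear_combination (E * O) ^ 2 * (F + E) * hz + E ^ 3 * hx + A * hy

lemma coeff_prod_eq_sum (n : ℕ) :
    (∏ m ∈ Icc 1 (2 * n), (((1 : ℤ[X]) - X ^ m) ^ 2 * (1 - X ^ (2 * m)) ^ 2)).coeff n =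
      ∑ x ∈ range (2 * n + 1) ×ˢ range (n + 1),
        if (x.1 - n : ℤ).natAbs ^ 2 + 2 * (x.2 + 1).choose 2 = n then
          (-1) ^ (n + x.1 + x.2) * (2 * x.2 + 1 : ℤ) else 0 := by
  have h := X_pow_dvd_iff.1 (X_pow_dvd_prod_sub_mul n) n (by omega)
  rw [coeff_sub, sub_eq_zero] at h
  rw [h, sum_mul_sum, sum_product, finsetSum_coeff]
  refine sum_congr rfl fun k _ => ?_
  rw [finsetSum_coeff]
  refine sum_congr rfl fun m _ => ?_
  have hc : (-1 : ℤ[X]) ^ (n + k) * (X : ℤ[X]) ^ ((k - n : ℤ).natAbs ^ 2) *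
      ((-1) ^ m * (2 * m + 1) * ((X : ℤ[X]) ^ 2) ^ (m + 1).choose 2) =
      C ((-1) ^ (n + k + m) * (2 * m + 1 : ℤ)) *
        (X : ℤ[X]) ^ ((k - n : ℤ).natAbs ^ 2 + 2 * (m + 1).choose 2) := by
    simp only [C_mul, C_pow, C_neg, C_1, C_add, C_ofNat, pow_add, pow_mul, map_natCast]
    ring
  rw [hc, coeff_C_mul_X_pow]
  simp only [eq_comm]

lemma sum_eq_sum_re_primaryOfNorm (n : ℕ) :
    (∑ x ∈ range (2 * n + 1) ×ˢ range (n + 1),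
        if (x.1 - n : ℤ).natAbs ^ 2 + 2 * (x.2 + 1).choose 2 = n then
          (-1) ^ (n + x.1 + x.2) * (2 * x.2 + 1 : ℤ) else 0) =
      ∑ α ∈ primaryOfNorm (4 * n + 1), α.re := by
  rw [← sum_filter]
  have key : ∀ k m : ℕ, (k - n : ℤ).natAbs ^ 2 + 2 * (m + 1).choose 2 = n ↔
      (2 * m + 1 : ℤ) ^ 2 + (2 * (k - n : ℤ)) ^ 2 = 4 * n + 1 := fun k m => by
    have c := choose_two_mul_two_add (m + 1)
    zify at c ⊢
    rw [sq_abs]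
    constructor <;> intro h <;> linarith
  refine sum_bij'
    (fun x _ => (⟨(-1) ^ (n + x.1 + x.2) * (2 * x.2 + 1), 2 * (x.1 - n)⟩ : GaussianInt))
    (fun α _ => ((α.im / 2 + n).toNat, (α.re.natAbs - 1) / 2)) ?_ ?_ ?_ ?_ ?_
  · rintro ⟨k, m⟩ hx
    simp only [mem_filter, key] at hx
    rw [mem_primaryOfNorm, GaussianInt.norm_eq_sq_add_sq, GaussianInt.IsPrimary]
    dsimp only
    refine ⟨?_, by omega, ?_⟩
    · rw [mul_pow, ← pow_mul, mul_comm _ 2, pow_mul]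
      push_cast
      simpa using hx.2
    · rcases Nat.even_or_odd (n + k + m) with h | h
      · rw [h.neg_one_pow]
        obtain ⟨c, hc⟩ := h
        omega
      · rw [h.neg_one_pow]
        obtain ⟨c, hc⟩ := h
        omega
  · intro α hα
    rw [mem_primaryOfNorm, GaussianInt.norm_eq_sq_add_sq, GaussianInt.IsPrimary] at hα
    obtain ⟨h1, h2, h3⟩ := hα
    obtain ⟨v, hv⟩ : ∃ v, α.im = 2 * v := ⟨α.im / 2, by omega⟩
    obtain ⟨m, hm⟩ : ∃ m : ℕ, α.re.natAbs = 2 * m + 1 := ⟨α.re.natAbs / 2, by omega⟩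
    have hm' : α.re ^ 2 = (2 * m + 1 : ℤ) ^ 2 := by
      rw [← Int.natAbs_sq, hm]
      push_cast
      rfl
    rw [hm', hv] at h1
    push_cast at h1
    have b1 : v ≤ n := by nlinarith
    have b2 : -n ≤ v := by nlinarith
    have b3 : (m : ℤ) ≤ n := by nlinarith
    have e1 : α.im / 2 = v := by omega
    have e2 : (α.re.natAbs - 1) / 2 = m := by omega
    have e3 : ((v + n).toNat : ℤ) = v + n := by omega
    simp only [mem_filter, key, mem_product, mem_range, e1, e2, e3]
    refine ⟨⟨by omega, by omega⟩, ?_⟩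
    rw [← h1]
    ring
  · rintro ⟨k, m⟩ hx
    dsimp only
    rw [Int.natAbs_mul, Int.natAbs_pow, Int.natAbs_neg, Int.natAbs_one, one_pow, one_mul]
    ext <;> dsimp only <;> omega
  · intro α hα
    rw [mem_primaryOfNorm, GaussianInt.norm_eq_sq_add_sq, GaussianInt.IsPrimary] at hα
    obtain ⟨h1, h2, h3⟩ := hα
    push_cast at h1
    have b2 : -n ≤ α.im / 2 := by
      have : α.im = 2 * (α.im / 2) := by omega
      nlinarith [sq_nonneg α.re]
    ext
    · dsimp only
      rcases Nat.even_or_odd (n + (α.im / 2 + n).toNat + (α.re.natAbs - 1) / 2) with h | h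
      · rw [h.neg_one_pow]
        obtain ⟨c, hc⟩ := h
        omega
      · rw [h.neg_one_pow]
        obtain ⟨c, hc⟩ := h
        omega
    · dsimp only
      omega
  · intro x _
    rfl

namespace GaussianInt

lemma norm_pow (α : GaussianInt) (n : ℕ) : (α ^ n).norm = α.norm ^ n :=
  map_pow (Zsqrtd.normMonoidHom (d := -1)) α n

lemma IsPrimary.mul {α β : GaussianInt} (hα : α.IsPrimary) (hβ : β.IsPrimary) :
    (α * β).IsPrimary := by
  obtain ⟨h1, h2⟩ := hα
  obtain ⟨h3, h4⟩ := hβ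
  obtain ⟨a, ha⟩ : ∃ a, α.im = 2 * a := ⟨α.im / 2, by omega⟩
  obtain ⟨b, hb⟩ : ∃ b, β.im = 2 * b := ⟨β.im / 2, by omega⟩
  obtain ⟨c, hc⟩ : ∃ c, α.re = 1 - α.im + 4 * c := ⟨(α.re + α.im) / 4, by omega⟩
  obtain ⟨d, hd⟩ : ∃ d, β.re = 1 - β.im + 4 * d := ⟨(β.re + β.im) / 4, by omega⟩
  rw [IsPrimary, Zsqrtd.re_mul, Zsqrtd.im_mul, hc, hd, ha, hb]
  constructor
  · rw [show (1 - 2 * a + 4 * c) * (2 * b) + 2 * a * (1 - 2 * b + 4 * d) =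
      2 * ((1 - 2 * a + 4 * c) * b + a * (1 - 2 * b + 4 * d)) by ring]
    omega
  · rw [show (1 - 2 * a + 4 * c) * (1 - 2 * b + 4 * d) + -1 * (2 * a) * (2 * b) +
      ((1 - 2 * a + 4 * c) * (2 * b) + 2 * a * (1 - 2 * b + 4 * d)) =
      1 + 4 * (c + d - 2 * a * b + 4 * c * d) by ring]
    omega

lemma isPrimary_one : IsPrimary 1 := by constructor <;> rfl

lemma IsPrimary.pow {α : GaussianInt} (hα : α.IsPrimary) (n : ℕ) : (α ^ n).IsPrimary := by
  induction n with
  | zero => simpa using isPrimary_one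
  | succ n ih => rw [pow_succ]; exact ih.mul hα

lemma IsPrimary.star {α : GaussianInt} (hα : α.IsPrimary) : (star α).IsPrimary := by
  obtain ⟨h1, h2⟩ := hα
  constructor
  · rw [Zsqrtd.im_star]; omega
  · rw [Zsqrtd.im_star, Zsqrtd.re_star]; omega

lemma norm_eq_of_associated {α β : GaussianInt} (h : Associated α β) : α.norm = β.norm :=
  Zsqrtd.norm_eq_of_associated (by norm_num) h

lemma IsPrimary.eq_of_associated {α β : GaussianInt} (hα : α.IsPrimary) (hβ : β.IsPrimary)
    (h : Associated α β) : α = β := by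
  obtain ⟨u, rfl⟩ := h
  have hu : (u : GaussianInt).norm = 1 := by
    have := Zsqrtd.norm_eq_one_iff.2 u.isUnit
    have := norm_nonneg u
    omega
  rw [norm_eq_sq_add_sq] at hu
  obtain ⟨h1, h2⟩ := hα
  obtain ⟨h3, h4⟩ := hβ
  rw [Zsqrtd.im_mul] at h3 h4
  rw [Zsqrtd.re_mul] at h4
  have b1 : (u : GaussianInt).re ≤ 1 := by nlinarith
  have b2 : -1 ≤ (u : GaussianInt).re := by nlinarith
  have b3 : (u : GaussianInt).im ≤ 1 := by nlinarith
  have b4 : -1 ≤ (u : GaussianInt).im := by nlinarith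
  have huu : (u : GaussianInt) = ⟨(u : GaussianInt).re, (u : GaussianInt).im⟩ := rfl
  generalize (u : GaussianInt).re = x at *
  generalize (u : GaussianInt).im = y at *
  have hx : x = -1 ∨ x = 0 ∨ x = 1 := by omega
  have hy : y = -1 ∨ y = 0 ∨ y = 1 := by omega
  rcases hx with rfl | rfl | rfl <;> rcases hy with rfl | rfl | rfl <;> norm_num at hu <;>
    first
    | omega
    | (rw [huu]; exact (mul_one α).symm)

lemma exists_isPrimary_associated {α : GaussianInt} (h : Odd α.norm) :
    ∃ β : GaussianInt, β.IsPrimary ∧ Associated α β := by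
  have hi : IsUnit (⟨0, 1⟩ : GaussianInt) := Zsqrtd.norm_eq_one_iff.1 rfl
  have key : ∀ γ : GaussianInt, γ.im % 2 = 0 → γ.re % 2 = 1 →
      ∃ β : GaussianInt, β.IsPrimary ∧ Associated γ β := fun γ h1 h2 => by
    by_cases h3 : (γ.re + γ.im) % 4 = 1
    · exact ⟨γ, ⟨h1, h3⟩, Associated.refl _⟩
    · refine ⟨-γ, ⟨?_, ?_⟩, (Associated.refl γ).neg_right⟩
      · rw [Zsqrtd.im_neg]; omega
      · rw [Zsqrtd.re_neg, Zsqrtd.im_neg]; omega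
  rw [norm_eq_sq_add_sq, Int.odd_add, Int.odd_pow' two_ne_zero, Int.even_pow' two_ne_zero,
    Int.odd_iff, Int.even_iff] at h
  by_cases h1 : α.re % 2 = 1
  · exact key α (h.1 h1) h1
  · obtain ⟨β, h2, h3⟩ := key (α * ⟨0, 1⟩) (by rw [Zsqrtd.im_mul]; dsimp only; omega)
      (by rw [Zsqrtd.re_mul]; dsimp only; omega)
    exact ⟨β, h2, (associated_mul_unit_left α _ hi).symm.trans h3⟩

lemma dvd_natCast_of_norm_eq {α : GaussianInt} {N : ℕ} (h : α.norm = N) : α ∣ (N : GaussianInt) :=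
  ⟨star α, by rw [← Zsqrtd.norm_eq_mul_conj, h, Int.cast_natCast]⟩

lemma isCoprime_of_norm_eq {α β : GaussianInt} {M N : ℕ} (hα : α.norm = M) (hβ : β.norm = N)
    (h : M.Coprime N) : IsCoprime α β :=
  ((Nat.isCoprime_iff_coprime.2 h).map (Int.castRingHom GaussianInt)).of_isCoprime_of_dvd_left
    (by simpa using dvd_natCast_of_norm_eq hα) |>.of_isCoprime_of_dvd_right
    (by simpa using dvd_natCast_of_norm_eq hβ)

lemma associated_of_dvd_of_norm_eq {α β : GaussianInt} (h : α ∣ β) (hn : α.norm = β.norm)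
    (h0 : α.norm ≠ 0) : Associated α β := by
  obtain ⟨γ, rfl⟩ := h
  rw [Zsqrtd.norm_mul] at hn
  have : γ.norm = 1 := mul_left_cancel₀ h0 (by rw [← hn, mul_one])
  exact (associated_mul_unit_right α γ (Zsqrtd.norm_eq_one_iff.1 (by rw [this]; rfl)))

lemma exists_mul_eq_of_norm_eq_mul {γ : GaussianInt} {M N : ℕ} (h : M.Coprime N)
    (hγ : γ.norm = (M * N : ℕ)) (h0 : M * N ≠ 0) :
    ∃ α β : GaussianInt, α.norm = M ∧ β.norm = N ∧ γ = α * β := by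
  have hd := dvd_natCast_of_norm_eq hγ
  rw [Nat.cast_mul] at hd
  obtain ⟨α, β, hα, hβ, rfl⟩ := exists_dvd_and_dvd_of_dvd_mul hd
  rw [Zsqrtd.norm_mul] at hγ
  have hdvd : ∀ {δ : GaussianInt} {K : ℕ}, δ ∣ (K : GaussianInt) → δ.norm ∣ (K : ℤ) * K := by
    rintro δ K ⟨ε, hε⟩
    rw [← Zsqrtd.norm_natCast (d := -1), hε, Zsqrtd.norm_mul]
    exact dvd_mul_right _ _
  obtain ⟨a, ha⟩ := Int.eq_ofNat_of_zero_le (norm_nonneg α)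
  obtain ⟨b, hb⟩ := Int.eq_ofNat_of_zero_le (norm_nonneg β)
  have h1 := hdvd hα
  have h2 := hdvd hβ
  rw [ha, hb] at hγ
  rw [ha] at h1
  rw [hb] at h2
  norm_cast at hγ h1 h2
  have h3 : a ∣ M := by
    have : a.Coprime N := Nat.Coprime.coprime_dvd_left h1 (h.mul_left h)
    exact this.dvd_of_dvd_mul_right ⟨b, hγ.symm⟩
  have h4 : b ∣ N := by
    have : b.Coprime M := Nat.Coprime.coprime_dvd_left h2 (h.symm.mul_left h.symm)
    exact this.dvd_of_dvd_mul_left ⟨a, by rw [← hγ, mul_comm]⟩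
  have hM : 0 < M := Nat.pos_of_ne_zero (left_ne_zero_of_mul h0)
  have hN : 0 < N := Nat.pos_of_ne_zero (right_ne_zero_of_mul h0)
  have h5 := Nat.le_of_dvd hM h3
  have h6 := Nat.le_of_dvd hN h4
  have h7 : a = M := by nlinarith
  have h8 : b = N := by nlinarith
  exact ⟨α, β, by rw [ha, h7], by rw [hb, h8], rfl⟩

end GaussianInt

open GaussianInt

lemma sum_primaryOfNorm_mul {M N : ℕ} (h : M.Coprime N) (hodd : Odd (M * N)) :
    ∑ γ ∈ primaryOfNorm (M * N), γ =
      (∑ α ∈ primaryOfNorm M, α) * ∑ β ∈ primaryOfNorm N, β := by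
  have h0 : M * N ≠ 0 := fun h => by simp [h] at hodd
  obtain ⟨hM, hN⟩ := Nat.odd_mul.1 hodd
  rw [sum_mul_sum, ← sum_product']
  symm
  refine sum_bij (fun x _ => x.1 * x.2) ?_ ?_ ?_ fun _ _ => rfl
  · rintro ⟨α, β⟩ hx
    simp only [mem_product, mem_primaryOfNorm] at hx ⊢
    refine ⟨?_, hx.1.2.mul hx.2.2⟩
    rw [Zsqrtd.norm_mul, hx.1.1, hx.2.1, Nat.cast_mul]
  · rintro ⟨α, β⟩ hx ⟨α', β'⟩ hx' heq
    simp only [mem_product, mem_primaryOfNorm] at hx hx' heq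
    have hne : (M : ℤ) ≠ 0 := Nat.cast_ne_zero.2 (left_ne_zero_of_mul h0)
    have hd : α ∣ α' := (isCoprime_of_norm_eq hx.1.1 hx'.2.1 h).dvd_of_dvd_mul_right ⟨β, heq.symm⟩
    have hα : α = α' := hx.1.2.eq_of_associated hx'.1.2
      (associated_of_dvd_of_norm_eq hd (hx.1.1.trans hx'.1.1.symm) (by rwa [hx.1.1]))
    have hα0 : α ≠ 0 := by
      rintro rfl
      exact hne (by rw [← hx.1.1]; rfl)
    rw [← hα] at heq
    rw [← hα, mul_left_cancel₀ hα0 heq]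
  · intro γ hγ
    rw [mem_primaryOfNorm] at hγ
    obtain ⟨α, β, hα, hβ, rfl⟩ := exists_mul_eq_of_norm_eq_mul h hγ.1 h0
    obtain ⟨α', h1, h2⟩ := exists_isPrimary_associated (α := α) (by rw [hα]; exact_mod_cast hM)
    obtain ⟨β', h3, h4⟩ := exists_isPrimary_associated (α := β) (by rw [hβ]; exact_mod_cast hN)
    refine ⟨(α', β'), ?_, ((h1.mul h3).eq_of_associated hγ.2 (h2.mul_mul h4).symm)⟩
    simp only [mem_product, mem_primaryOfNorm]
    exact ⟨⟨(norm_eq_of_associated h2).symm.trans hα, h1⟩,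
      (norm_eq_of_associated h4).symm.trans hβ, h3⟩

lemma isPrimary_neg_natCast {p : ℕ} (hp : p % 4 = 3) : IsPrimary (-p : GaussianInt) := by
  constructor
  · simp
  · simp only [Zsqrtd.re_neg, Zsqrtd.im_neg, Zsqrtd.re_natCast, Zsqrtd.im_natCast]
    omega

lemma primaryOfNorm_pow_of_mod_four_eq_three {p : ℕ} (hp : p.Prime) (h3 : p % 4 = 3) (r : ℕ) :
    primaryOfNorm (p ^ r) = if Even r then {(-p : GaussianInt) ^ (r / 2)} else ∅ := by
  have : Fact p.Prime := ⟨hp⟩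
  have hP : Prime (p : GaussianInt) := (prime_iff_mod_four_eq_three_of_nat_prime p).2 h3
  have hn : ∀ i : ℕ, ((-p : GaussianInt) ^ i).norm = (p : ℤ) ^ (2 * i) := fun i => by
    rw [norm_pow, Zsqrtd.norm_neg, Zsqrtd.norm_natCast, pow_mul]
    ring
  have key : ∀ α ∈ primaryOfNorm (p ^ r), ∃ i, r = 2 * i ∧ α = (-p : GaussianInt) ^ i := by
    intro α hα
    rw [mem_primaryOfNorm] at hα
    have hd := dvd_natCast_of_norm_eq hα.1
    rw [Nat.cast_pow, dvd_prime_pow hP] at hd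
    obtain ⟨i, -, hi⟩ := hd
    have heq := hα.2.eq_of_associated ((isPrimary_neg_natCast h3).pow i)
      (hi.trans ((Associated.refl (p : GaussianInt)).neg_right.pow_pow))
    refine ⟨i, ?_, heq⟩
    have := hα.1
    rw [heq, hn] at this
    exact (Nat.pow_right_injective hp.two_le (by exact_mod_cast this)).symm
  split_ifs with h
  · ext α
    rw [mem_singleton]
    constructor
    · intro hα
      obtain ⟨i, rfl, rfl⟩ := key α hα
      simp
    · rintro rfl
      rw [mem_primaryOfNorm, hn, Nat.two_mul_div_two_of_even h]
      exact ⟨by push_cast; rfl, (isPrimary_neg_natCast h3).pow _⟩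
  · refine eq_empty_of_forall_notMem fun α hα => h ?_
    obtain ⟨i, rfl, -⟩ := key α hα
    exact even_two_mul i

lemma prime_of_norm_eq_prime {π : GaussianInt} {p : ℕ} (hp : p.Prime) (h : π.norm = p) :
    Prime π := by
  refine Irreducible.prime ⟨fun hu => ?_, fun a b hab => ?_⟩
  · have := Zsqrtd.norm_eq_one_iff.2 hu
    rw [h, Int.natAbs_natCast] at this
    exact hp.one_lt.ne' this
  · rw [← Zsqrtd.norm_eq_one_iff, ← Zsqrtd.norm_eq_one_iff]
    have : a.norm.natAbs * b.norm.natAbs = p := by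
      rw [← Int.natAbs_mul, ← Zsqrtd.norm_mul, ← hab, h, Int.natAbs_natCast]
    rcases Nat.prime_mul_iff.1 (this ▸ hp) with h | h
    · exact Or.inr h.2
    · exact Or.inl h.2

lemma norm_pow_mul_star_pow (π : GaussianInt) (i j : ℕ) :
    (π ^ i * star π ^ j).norm = π.norm ^ (i + j) := by
  rw [Zsqrtd.norm_mul, norm_pow, norm_pow, Zsqrtd.norm_conj, pow_add]

lemma mem_primaryOfNorm_pow {π : GaussianInt} {p : ℕ} (hp : p.Prime) (h : π.norm = p)
    (hπ : π.IsPrimary) {r : ℕ} {α : GaussianInt} :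
    α ∈ primaryOfNorm (p ^ r) ↔ ∃ j ≤ r, α = π ^ j * star π ^ (r - j) := by
  constructor
  · intro hα
    rw [mem_primaryOfNorm] at hα
    have hd := dvd_natCast_of_norm_eq hα.1
    have hpp : (p : GaussianInt) = π * star π := by
      rw [← Zsqrtd.norm_eq_mul_conj, h, Int.cast_natCast]
    rw [Nat.cast_pow, hpp, mul_pow] at hd
    obtain ⟨β, γ, hβ, hγ, hβγ⟩ := exists_dvd_and_dvd_of_dvd_mul hd
    rw [dvd_prime_pow (prime_of_norm_eq_prime hp h)] at hβ
    rw [dvd_prime_pow (prime_of_norm_eq_prime hp ((Zsqrtd.norm_conj π).trans h))] at hγ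
    obtain ⟨i, -, hi⟩ := hβ
    obtain ⟨j, -, hj⟩ := hγ
    have heq : α = π ^ i * star π ^ j :=
      hα.2.eq_of_associated ((hπ.pow i).mul (hπ.star.pow j)) (hβγ ▸ hi.mul_mul hj)
    have hn := hα.1
    rw [heq, norm_pow_mul_star_pow, h] at hn
    have hr : i + j = r := Nat.pow_right_injective hp.two_le (by exact_mod_cast hn)
    exact ⟨i, by omega, by rw [heq, ← hr, Nat.add_sub_cancel_left]⟩
  · rintro ⟨j, hj, rfl⟩
    rw [mem_primaryOfNorm, norm_pow_mul_star_pow, h, Nat.add_sub_cancel' hj]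
    exact ⟨by push_cast; rfl, (hπ.pow _).mul (hπ.star.pow _)⟩

lemma not_dvd_star_of_norm_eq_prime {π : GaussianInt} {p : ℕ} (hp : p.Prime) (h : π.norm = p)
    (hπ : π.IsPrimary) : ¬ π ∣ star π := by
  intro hd
  have heq := hπ.eq_of_associated hπ.star (associated_of_dvd_of_norm_eq hd (Zsqrtd.norm_conj π).symm
    (by rw [h]; exact_mod_cast hp.ne_zero))
  have him := congrArg Zsqrtd.im heq
  rw [Zsqrtd.im_star] at him
  have him0 : π.im = 0 := by omega
  rw [norm_eq_sq_add_sq, him0] at h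
  have h1 : π.re.natAbs ^ 2 = p := by
    zify
    rw [sq_abs, ← h]
    ring
  exact Nat.Prime.not_prime_pow le_rfl (h1 ▸ hp)

lemma sum_primaryOfNorm_pow {π : GaussianInt} {p : ℕ} (hp : p.Prime) (h : π.norm = p)
    (hπ : π.IsPrimary) (r : ℕ) :
    ∑ α ∈ primaryOfNorm (p ^ r), α = ∑ j ∈ range (r + 1), π ^ j * star π ^ (r - j) := by
  symm
  refine sum_bij (fun j _ => π ^ j * star π ^ (r - j)) ?_ ?_ ?_ fun _ _ => rfl
  · exact fun j hj => (mem_primaryOfNorm_pow hp h hπ).2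
      ⟨j, Nat.lt_succ_iff.1 (mem_range.1 hj), rfl⟩
  · have key : ∀ i j : ℕ, i < j → j ≤ r →
        π ^ i * star π ^ (r - i) ≠ π ^ j * star π ^ (r - j) := by
      intro i j hij hjr heq
      have hP := prime_of_norm_eq_prime hp h
      rw [show j = i + (j - i - 1 + 1) by omega, pow_add, mul_assoc, pow_succ' π (j - i - 1),
        mul_assoc] at heq
      have hd := mul_left_cancel₀ (pow_ne_zero i hP.ne_zero) heq
      exact not_dvd_star_of_norm_eq_prime hp h hπ (hP.dvd_of_dvd_pow ⟨_, hd⟩)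
    intro i hi j hj heq
    rw [mem_range] at hi hj
    by_contra hne
    rcases lt_or_gt_of_ne hne with hlt | hlt
    · exact key i j hlt (by omega) heq
    · exact key j i hlt (by omega) heq.symm
  · intro α hα
    obtain ⟨j, hj, rfl⟩ := (mem_primaryOfNorm_pow hp h hπ).1 hα
    exact ⟨j, mem_range.2 (by omega), rfl⟩

lemma isPrimary_neg_one_pow_mul {u v : ℕ} (hu : Odd u) (hv : Even v) :
    IsPrimary (⟨(-1) ^ ((u + v - 1) / 2) * u, (-1) ^ ((u + v - 1) / 2) * v⟩ : GaussianInt) := by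
  obtain ⟨a, rfl⟩ := hu
  obtain ⟨b, rfl⟩ := hv
  rw [show (2 * a + 1 + (b + b) - 1) / 2 = a + b by omega]
  rcases Nat.even_or_odd (a + b) with h | h
  · rw [h.neg_one_pow]
    obtain ⟨c, hc⟩ := h
    constructor <;> dsimp only <;> omega
  · rw [h.neg_one_pow]
    obtain ⟨c, hc⟩ := h
    constructor <;> dsimp only <;> omega

lemma norm_neg_one_pow_mul (e u v : ℕ) :
    Zsqrtd.norm (⟨(-1) ^ e * u, (-1) ^ e * v⟩ : GaussianInt) = (u ^ 2 + v ^ 2 : ℕ) := by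
  rw [norm_eq_sq_add_sq]
  dsimp only
  rw [mul_pow, mul_pow, ← pow_mul, mul_comm e 2, pow_mul]
  push_cast
  ring

/-- A prime `p ≡ 1 (mod 4)` is uniquely the sum of an odd square and an even square. -/
lemma existsUnique_odd_even_sq_add_sq {p : ℕ} (hp : p.Prime) (h1 : p % 4 = 1) :
    ∃! uv : ℕ × ℕ, 0 < uv.1 ∧ 0 < uv.2 ∧ Odd uv.1 ∧ Even uv.2 ∧ p = uv.1 ^ 2 + uv.2 ^ 2 := by
  have : Fact p.Prime := ⟨hp⟩
  have hex : ∃ u v : ℕ, Odd u ∧ Even v ∧ p = u ^ 2 + v ^ 2 := by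
    obtain ⟨a, b, hab⟩ := Nat.Prime.sq_add_sq (p := p) (by omega)
    have hodd : Odd (a ^ 2 + b ^ 2) := by rw [hab, Nat.odd_iff]; omega
    rw [Nat.odd_add, Nat.odd_pow_iff two_ne_zero, Nat.even_pow' two_ne_zero] at hodd
    rcases Nat.even_or_odd a with ha | ha
    · refine ⟨b, a, ?_, ha, by rw [← hab, add_comm]⟩
      rw [← Nat.not_even_iff_odd]
      exact fun hb => Nat.not_odd_iff_even.2 ha (hodd.2 hb)
    · exact ⟨a, b, ha, hodd.1 ha, hab.symm⟩
  obtain ⟨u, v, hu, hv, huv⟩ := hex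
  have hv0 : 0 < v := by
    rcases Nat.eq_zero_or_pos v with rfl | hv0
    · rw [zero_pow two_ne_zero, add_zero] at huv
      exact absurd (huv ▸ hp) (Nat.Prime.not_prime_pow le_rfl)
    · exact hv0
  refine ⟨(u, v), ⟨hu.pos, hv0, hu, hv, huv⟩, ?_⟩
  rintro ⟨x, y⟩ ⟨-, -, hx, hy, hxy⟩
  dsimp only at hx hy hxy
  have hmem : (⟨(-1) ^ ((x + y - 1) / 2) * x, (-1) ^ ((x + y - 1) / 2) * y⟩ : GaussianInt) ∈
      primaryOfNorm (p ^ 1) := by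
    rw [mem_primaryOfNorm, norm_neg_one_pow_mul, pow_one, ← hxy]
    exact ⟨rfl, isPrimary_neg_one_pow_mul hx hy⟩
  rw [mem_primaryOfNorm_pow hp ((norm_neg_one_pow_mul ((u + v - 1) / 2) u v).trans (by rw [← huv]))
    (isPrimary_neg_one_pow_mul hu hv)] at hmem
  obtain ⟨j, hj, heq⟩ := hmem
  have hre := congrArg (fun z : GaussianInt => z.re.natAbs) heq
  have him := congrArg (fun z : GaussianInt => z.im.natAbs) heq
  interval_cases j <;>
    simp [Int.natAbs_mul, Int.natAbs_pow] at hre him <;> rw [hre, him]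

theorem stmt_13 (b : ℕ → ℤ)
    (hb : ∀ n N : ℕ, n ≤ N →
      b n = ((∏ m ∈ Finset.Icc 1 N,
        (((1 : Polynomial ℤ) - Polynomial.X ^ m) ^ 2 *
          ((1 : Polynomial ℤ) - Polynomial.X ^ (2 * m)) ^ 2)).coeff n))
    (g : ℕ → ℤ)
    (hg1 : g 1 = 1)
    (hgmul : ∀ m n : ℕ, Nat.Coprime m n → g (m * n) = g m * g n)
    (hga : ∀ p r : ℕ, p.Prime → 1 ≤ r → p % 4 = 3 → Even r →
      g (p ^ r) = (-1) ^ (r / 2) * (p : ℤ) ^ (r / 2))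
    (hgb : ∀ p r u v : ℕ, p.Prime → 1 ≤ r → p % 4 = 1 → 0 < u → 0 < v →
      Odd u → Even v → p = u ^ 2 + v ^ 2 →
      (g (p ^ r) : ℂ) =
        (if Odd r then (-1 : ℂ) ^ ((u + v - 1) / 2) else 1) *
          (((u : ℂ) + Complex.I * v) ^ (r + 1) -
            ((u : ℂ) - Complex.I * v) ^ (r + 1)) /
          (2 * Complex.I * v))
    (hg0 : ∀ p r : ℕ, p.Prime → 1 ≤ r → ¬(p % 4 = 1) → ¬(p % 4 = 3 ∧ Even r) →
      g (p ^ r) = 0) :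
    (∀ p : ℕ, p.Prime → p % 4 = 1 →
      ∃! uv : ℕ × ℕ, 0 < uv.1 ∧ 0 < uv.2 ∧ Odd uv.1 ∧ Even uv.2 ∧
        p = uv.1 ^ 2 + uv.2 ^ 2) ∧
    ∀ n : ℕ, b n = g (4 * n + 1) := by
  refine ⟨fun p hp h1 => existsUnique_odd_even_sq_add_sq hp h1, fun n => ?_⟩
  have key : ∀ N : ℕ, Odd N → (g N : GaussianInt) = ∑ α ∈ primaryOfNorm N, α := by
    intro N
    induction N using Nat.recOnPosPrimePosCoprime with
    | zero => exact fun h => absurd h (by decide)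
    | one =>
      intro _
      have h := primaryOfNorm_pow_of_mod_four_eq_three Nat.prime_three rfl 0
      rw [pow_zero, if_pos (by decide)] at h
      simp [h, hg1]
    | coprime M N _ _ h ihM ihN =>
      intro hodd
      obtain ⟨hM, hN⟩ := Nat.odd_mul.1 hodd
      rw [hgmul M N h, sum_primaryOfNorm_mul h hodd, ← ihM hM, ← ihN hN, Int.cast_mul]
    | prime_pow p r hp hr =>
      intro hodd
      have hp2 : p % 2 = 1 := Nat.odd_iff.1 ((Nat.odd_pow_iff hr.ne').1 hodd)
      have h4 : p % 4 = 1 ∨ p % 4 = 3 := by omega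
      rcases h4 with h1 | h3
      · obtain ⟨⟨u, v⟩, ⟨hu0, hv0, hu, hv, huv⟩, -⟩ := existsUnique_odd_even_sq_add_sq hp h1
        dsimp only at hu0 hv0 hu hv huv
        rw [sum_primaryOfNorm_pow hp
          ((norm_neg_one_pow_mul ((u + v - 1) / 2) u v).trans (by rw [← huv]))
          (isPrimary_neg_one_pow_mul hu hv)]
        apply toComplex_injective
        rw [map_intCast, hgb p r u v hp hr h1 hu0 hv0 hu hv huv,
          div_eq_iff (by simp [hv0.ne'])]
        simp only [map_sum, map_mul, map_pow, toComplex_star]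
        rw [toComplex_def']
        push_cast
        set ε : ℂ := (-1) ^ ((u + v - 1) / 2) with hε
        have hε2 : ε * ε = 1 := by rw [hε, ← mul_pow]; simp
        have hεc : (starRingEnd ℂ) ε = ε := by rw [hε]; simp
        have hε0 : ε ≠ 0 := left_ne_zero_of_mul (hε2.trans_ne one_ne_zero)
        have hg := geom_sum₂_mul (ε * u + ε * v * Complex.I) (ε * u - ε * v * Complex.I) (r + 1)
        have hε' : (if Odd r then ε else 1) = ε ^ r := by
          split_ifs with h
          · obtain ⟨c, rfl⟩ := h
            rw [pow_succ, pow_mul, sq, hε2, one_pow, one_mul]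
          · obtain ⟨c, rfl⟩ := Nat.not_odd_iff_even.1 h
            rw [← two_mul, pow_mul, sq, hε2, one_pow]
        have hconj : (starRingEnd ℂ) (ε * u + ε * v * Complex.I) = ε * u - ε * v * Complex.I := by
          simp [hεc]
          ring
        rw [hconj, hε']
        rw [show ε * u + ε * v * Complex.I = ε * (u + Complex.I * v) by ring,
          show ε * u - ε * v * Complex.I = ε * (u - Complex.I * v) by ring] at hg ⊢
        refine mul_left_cancel₀ hε0 (Eq.trans ?_ (hg.symm.trans ?_))
        · rw [mul_pow, mul_pow]
          ring
        · rw [show ε * (u + Complex.I * v) - ε * (u - Complex.I * v) =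
            ε * (2 * Complex.I * v) by ring]
          simp only [Nat.add_sub_cancel]
          ring
      · rw [primaryOfNorm_pow_of_mod_four_eq_three hp h3]
        split_ifs with h
        · rw [hga p r hp hr h3 h, sum_singleton, ← mul_pow]
          simp
        · rw [hg0 p r hp hr (by omega) (fun h' => h h'.2)]
          simp
  have h := congrArg Zsqrtd.re (key (4 * n + 1) ⟨2 * n, by ring⟩)
  rw [Zsqrtd.re_intCast] at h
  rw [hb n (2 * n) (by omega), coeff_prod_eq_sum, sum_eq_sum_re_primaryOfNorm, h]
  exact (map_sum (⟨⟨Zsqrtd.re, rfl⟩, Zsqrtd.re_add⟩ : GaussianInt →+ ℤ) _ _).symm
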